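/- Let μ₁ be the uniform distribution on [−1,1] (density ½·1_{[−1,1]} with respect to Lebesgue measure) and let μ₂ be the probability measure on ℝ with density (2+s)/3 on [−2,−1], 1/3 on [−1,1], and (2−s)/3 on [1,2] (and 0 elsewhere). Then inf{∫ |s₂ − s₁| dQ(s₁,s₂) : Q ∈ M(μ₁, μ₂)} = 1/3, and the infimum is attained by the martingale measure Q whose disintegration with respect to μ₁ is Q_{s₁} = a(s₁)·δ_{f(s₁)} + (2/3)·δ_{s₁} + c(s₁)·δ_{g(s₁)} with f(s₁) = −(3+s₁)/2, g(s₁) = (3−s₁)/2, a(s₁) = −f′(s₁)·(dμ₂/dλ)(f(s₁))/(dμ₁/dλ)(s₁) and c(s₁) = −g′(s₁)·(dμ₂/dλ)(g(s₁))/(dμ₁/dλ)(s₁). -/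

import Mathlib

open MeasureTheory
open scoped BigOperators ENNReal

noncomputable section

namespace MOT2

/-- `Q ∈ M(μ₁, μ₂)`: `Q` is a Borel probability measure on `ℝ²` with marginals `μ₁, μ₂`
under which the coordinate process `(S₁, S₂)` is a martingale, i.e.
`∫ Δ(s₁)(s₂ - s₁) dQ = 0` for every bounded measurable `Δ : ℝ → ℝ`. -/
def IsMartingaleCoupling (Q : Measure (ℝ × ℝ)) (μ₁ μ₂ : Measure ℝ) : Prop :=
  IsProbabilityMeasure Q ∧ Q.map Prod.fst = μ₁ ∧ Q.map Prod.snd = μ₂ ∧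
    ∀ Δ : ℝ → ℝ, Measurable Δ → (∃ C, ∀ x, |Δ x| ≤ C) →
      ∫ p : ℝ × ℝ, Δ p.1 * (p.2 - p.1) ∂Q = 0

end MOT2

namespace ForwardStraddle

/-- Density of `μ₁`: the uniform distribution on `[-1, 1]`. -/
def ρ₁ (s : ℝ) : ℝ := if -1 ≤ s ∧ s ≤ 1 then 1 / 2 else 0

/-- Density of `μ₂`: `(2+s)/3` on `[-2, -1]`, `1/3` on `[-1, 1]`, `(2-s)/3` on `[1, 2]`. -/
def ρ₂ (s : ℝ) : ℝ :=
  if -2 ≤ s ∧ s ≤ -1 then (2 + s) / 3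
  else if -1 < s ∧ s < 1 then 1 / 3
  else if 1 ≤ s ∧ s ≤ 2 then (2 - s) / 3
  else 0

/-- The first marginal `μ₁`. -/
noncomputable def μ₁ : Measure ℝ := volume.withDensity fun s => ENNReal.ofReal (ρ₁ s)

/-- The second marginal `μ₂`. -/
noncomputable def μ₂ : Measure ℝ := volume.withDensity fun s => ENNReal.ofReal (ρ₂ s)

/-- The left target `f(s₁) = -(3 + s₁)/2`. -/
def f (s₁ : ℝ) : ℝ := -(3 + s₁) / 2

/-- The right target `g(s₁) = (3 - s₁)/2`. -/
def g (s₁ : ℝ) : ℝ := (3 - s₁) / 2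

/-- `a(s₁) = -f'(s₁) ⬝ (dμ₂/dλ)(f(s₁)) / (dμ₁/dλ)(s₁)`. -/
noncomputable def a (s₁ : ℝ) : ℝ := -deriv f s₁ * ρ₂ (f s₁) / ρ₁ s₁

/-- `c(s₁) = -g'(s₁) ⬝ (dμ₂/dλ)(g(s₁)) / (dμ₁/dλ)(s₁)`. -/
noncomputable def c (s₁ : ℝ) : ℝ := -deriv g s₁ * ρ₂ (g s₁) / ρ₁ s₁

/-- The disintegration kernel `Q_{s₁} = a(s₁) δ_{f(s₁)} + (2/3) δ_{s₁} + c(s₁) δ_{g(s₁)}`. -/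
noncomputable def κ (s₁ : ℝ) : Measure ℝ :=
  ENNReal.ofReal (a s₁) • Measure.dirac (f s₁) +
    ENNReal.ofReal (2 / 3 : ℝ) • Measure.dirac s₁ +
    ENNReal.ofReal (c s₁) • Measure.dirac (g s₁)

end ForwardStraddle

namespace ForwardStraddle

open Set

/-! ### The marginals -/

theorem μ₁_eq : μ₁ = (volume.restrict (Icc (-1) 1)).withDensity fun _ => ENNReal.ofReal (1 / 2) := by
  rw [← withDensity_indicator measurableSet_Icc, μ₁]
  congr 1
  ext s
  by_cases hs : s ∈ Icc (-1 : ℝ) 1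
  · rw [indicator_of_mem hs, ρ₁, if_pos (mem_Icc.1 hs)]
  · rw [indicator_of_notMem hs, ρ₁, if_neg (mt mem_Icc.2 hs), ENNReal.ofReal_zero]

instance isProbabilityMeasure_μ₁ : IsProbabilityMeasure μ₁ := by
  constructor
  rw [μ₁_eq, withDensity_const]
  simp only [Measure.smul_apply, Measure.restrict_apply_univ, Real.volume_Icc, smul_eq_mul]
  rw [← ENNReal.ofReal_mul (by norm_num)]
  norm_num

theorem ae_μ₁_mem : ∀ᵐ s ∂μ₁, s ∈ Icc (-1 : ℝ) 1 := by
  rw [μ₁_eq]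
  exact (withDensity_absolutelyContinuous _ _).ae_le (ae_restrict_mem measurableSet_Icc)

/-- `μ₂` decomposes along the three affine pieces of its density. -/
theorem μ₂_eq : μ₂ =
    (volume.restrict (Icc (-2) (-1))).withDensity (fun s => ENNReal.ofReal ((2 + s) / 3)) +
    (volume.restrict (Icc (-1) 1)).withDensity (fun _ => ENNReal.ofReal (1 / 3)) +
    (volume.restrict (Icc 1 2)).withDensity (fun s => ENNReal.ofReal ((2 - s) / 3)) := by
  rw [← withDensity_indicator measurableSet_Icc, ← withDensity_indicator measurableSet_Icc,
    ← withDensity_indicator measurableSet_Icc, ← withDensity_add_left, ← withDensity_add_left, μ₂]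
  · refine withDensity_congr_ae ?_
    filter_upwards [Measure.ae_ne volume (-1 : ℝ), Measure.ae_ne volume (1 : ℝ)] with s h₁ h₂
    simp only [Pi.add_apply, indicator_apply, mem_Icc, ρ₂]
    rcases lt_or_gt_of_ne h₁ with h | h
    · have h' : ¬ -1 ≤ s := h.not_ge
      have h'' : ¬ 1 ≤ s := by linarith
      have h3 : ¬ -1 < s := by linarith
      by_cases h4 : -2 ≤ s <;> simp [h', h'', h3, h4, h.le]
    · have h' : ¬ s ≤ -1 := h.not_ge
      rcases lt_or_gt_of_ne h₂ with k | k
      · have k' : ¬ 1 ≤ s := k.not_ge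
        simp [h', h, h.le, k, k.le, k']
      · have k' : ¬ s < 1 := by linarith
        have k'' : ¬ s ≤ 1 := by linarith
        by_cases k3 : s ≤ 2 <;> simp [h', k', k'', k.le, k3]
  · exact ((by fun_prop : Measurable fun s : ℝ => ENNReal.ofReal ((2 + s) / 3)).indicator
      measurableSet_Icc).add (measurable_const.indicator measurableSet_Icc)
  · exact (by fun_prop : Measurable fun s : ℝ => ENNReal.ofReal ((2 + s) / 3)).indicator
      measurableSet_Icc

theorem ae_μ₂_mem : ∀ᵐ s ∂μ₂, s ∈ Icc (-2 : ℝ) 2 := by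
  have key : ∀ {u v : ℝ} {w : ℝ → ℝ≥0∞}, -2 ≤ u → v ≤ 2 →
      ∀ᵐ s ∂(volume.restrict (Icc u v)).withDensity w, s ∈ Icc (-2 : ℝ) 2 := by
    intro u v w hu hv
    filter_upwards [(withDensity_absolutelyContinuous _ w).ae_le
      (ae_restrict_mem (μ := volume) (measurableSet_Icc (a := u) (b := v)))] with s hs
    exact Icc_subset_Icc hu hv hs
  rw [μ₂_eq, ae_add_measure_iff, ae_add_measure_iff]
  exact ⟨⟨key (by norm_num) (by norm_num), key (by norm_num) (by norm_num)⟩,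
    key (by norm_num) (by norm_num)⟩

/-! ### The candidate optimal coupling -/

/-- Mass with density `w` on `[-1, 1]`, transported along the graph of `T`. -/
def branch (w T : ℝ → ℝ) : Measure (ℝ × ℝ) :=
  ((volume.restrict (Icc (-1) 1)).withDensity fun x => ENNReal.ofReal (w x)).map
    fun x => (x, T x)

theorem map_fst_branch (w : ℝ → ℝ) {T : ℝ → ℝ} (hT : Measurable T) :
    (branch w T).map Prod.fst =
      (volume.restrict (Icc (-1) 1)).withDensity fun x => ENNReal.ofReal (w x) := by
  rw [branch, Measure.map_map measurable_fst (by fun_prop)]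
  exact Measure.map_id

theorem map_snd_branch (w : ℝ → ℝ) {T : ℝ → ℝ} (hT : Measurable T) :
    (branch w T).map Prod.snd =
      ((volume.restrict (Icc (-1) 1)).withDensity fun x => ENNReal.ofReal (w x)).map T := by
  rw [branch, Measure.map_map measurable_snd (by fun_prop)]
  rfl

theorem branch_prod (w : ℝ → ℝ) {T : ℝ → ℝ} (hT : Measurable T) {A B : Set ℝ}
    (hA : MeasurableSet A) (hB : MeasurableSet B) :
    branch w T (A ×ˢ B) = ∫⁻ x in A, ENNReal.ofReal (w x) * Measure.dirac (T x) B
      ∂volume.restrict (Icc (-1) 1) := by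
  rw [branch, Measure.map_apply (by fun_prop) (hA.prod hB),
    withDensity_apply _ ((by fun_prop : Measurable fun x => (x, T x)) (hA.prod hB)),
    show (fun x => (x, T x)) ⁻¹' A ×ˢ B = T ⁻¹' B ∩ A from by ext; simp [and_comm],
    ← Measure.restrict_restrict (hT hB), ← lintegral_indicator (hT hB)]
  refine lintegral_congr fun x => ?_
  by_cases h : T x ∈ B <;> simp [h, hB]

theorem integrable_branch {w T : ℝ → ℝ} (hw : Measurable w) (hw0 : ∀ x ∈ Icc (-1 : ℝ) 1, 0 ≤ w x)
    (hw1 : ∀ x ∈ Icc (-1 : ℝ) 1, w x ≤ 1) (hT : Measurable T)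
    (hT' : MapsTo T (Icc (-1) 1) (Icc (-2) 2)) {F : ℝ × ℝ → ℝ} (hF : Measurable F) {C : ℝ}
    (hC : ∀ p ∈ Icc (-1 : ℝ) 1 ×ˢ Icc (-2 : ℝ) 2, |F p| ≤ C) :
    Integrable F (branch w T) ∧ IntegrableOn (fun x => w x * F (x, T x)) (Icc (-1) 1) ∧
      ∫ p, F p ∂branch w T = ∫ x in Icc (-1) 1, w x * F (x, T x) := by
  have hwm : Measurable fun x => ENNReal.ofReal (w x) := by fun_prop
  have htop : ∀ᵐ x ∂volume.restrict (Icc (-1 : ℝ) 1), ENNReal.ofReal (w x) < ∞ :=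
    .of_forall fun _ => ENNReal.ofReal_lt_top
  have hae : (fun x => (ENNReal.ofReal (w x)).toReal • F (x, T x))
      =ᵐ[volume.restrict (Icc (-1 : ℝ) 1)] fun x => w x * F (x, T x) := by
    filter_upwards [ae_restrict_mem measurableSet_Icc] with x hx
    rw [ENNReal.toReal_ofReal (hw0 x hx), smul_eq_mul]
  have hint : IntegrableOn (fun x => w x * F (x, T x)) (Icc (-1) 1) := by
    refine Measure.integrableOn_of_bounded (M := C) (by simp) (by fun_prop) ?_
    filter_upwards [ae_restrict_mem measurableSet_Icc] with x hx
    rw [norm_mul, Real.norm_eq_abs, Real.norm_eq_abs, abs_of_nonneg (hw0 x hx)]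
    exact (mul_le_of_le_one_left (abs_nonneg _) (hw1 x hx)).trans (hC _ ⟨hx, hT' hx⟩)
  have hm : Measurable fun x => (x, T x) := by fun_prop
  refine ⟨?_, hint, ?_⟩
  · rw [branch, integrable_map_measure hF.aestronglyMeasurable hm.aemeasurable,
      integrable_withDensity_iff_integrable_smul' hwm htop]
    exact hint.congr hae.symm
  · rw [branch, integral_map hm.aemeasurable hF.aestronglyMeasurable,
      integral_withDensity_eq_integral_toReal_smul hwm htop]
    exact integral_congr_ae hae

theorem measurable_f : Measurable f := by unfold f; fun_prop

theorem measurable_g : Measurable g := by unfold g; fun_prop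

theorem mapsTo_f : MapsTo f (Icc (-1) 1) (Icc (-2) 2) := by
  rintro x ⟨h₁, h₂⟩
  constructor <;> unfold f <;> linarith

theorem mapsTo_g : MapsTo g (Icc (-1) 1) (Icc (-2) 2) := by
  rintro x ⟨h₁, h₂⟩
  constructor <;> unfold g <;> linarith

theorem hasDerivAt_f (x : ℝ) : HasDerivAt f (-1 / 2) x :=
  (((hasDerivAt_id x).const_add 3).neg).div_const 2

theorem hasDerivAt_g (x : ℝ) : HasDerivAt g (-1 / 2) x :=
  ((hasDerivAt_id x).const_sub 3).div_const 2

theorem a_eq {x : ℝ} (hx : x ∈ Icc (-1 : ℝ) 1) : a x = (1 - x) / 6 := by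
  have h₁ := hx.1
  have h₂ := hx.2
  have hf : -2 ≤ f x ∧ f x ≤ -1 := by constructor <;> unfold f <;> linarith
  rw [a, (hasDerivAt_f x).deriv, ρ₂, if_pos hf, ρ₁, if_pos (mem_Icc.1 hx), f]
  ring

theorem c_eq {x : ℝ} (hx : x ∈ Icc (-1 : ℝ) 1) : c x = (1 + x) / 6 := by
  have h₁ := hx.1
  have h₂ := hx.2
  have hg : 1 ≤ g x ∧ g x ≤ 2 := by constructor <;> unfold g <;> linarith
  rw [c, (hasDerivAt_g x).deriv, ρ₂, if_neg (fun h => by linarith [h.2]),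
    if_neg (fun h => by linarith [h.2]), if_pos hg, ρ₁, if_pos (mem_Icc.1 hx), g]
  ring

/-- Change of variables along an affine map of slope `-1/2`. -/
theorem map_withDensity_of_hasDerivAt {T w v : ℝ → ℝ} (hT : ∀ x, HasDerivAt T (-1 / 2) x)
    (hw : Measurable w) (hwv : ∀ x ∈ Icc (-1 : ℝ) 1, w x = 1 / 2 * v (T x)) {s : Set ℝ}
    (hv : Measurable v) (hinj : Function.Injective T) (hs : T '' Icc (-1) 1 = s) :
    ((volume.restrict (Icc (-1) 1)).withDensity fun x => ENNReal.ofReal (w x)).map T =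
      (volume.restrict s).withDensity fun y => ENNReal.ofReal (v y) := by
  have hTm : Measurable T :=
    (continuous_iff_continuousAt.2 fun x => (hT x).continuousAt).measurable
  refine Measure.ext_of_lintegral _ fun h hh => ?_
  rw [lintegral_map hh hTm, lintegral_withDensity_eq_lintegral_mul _ (by fun_prop) (by fun_prop),
    lintegral_withDensity_eq_lintegral_mul _ (by fun_prop) hh, ← hs,
    lintegral_image_eq_lintegral_abs_deriv_mul measurableSet_Icc
      (fun x _ => (hT x).hasDerivWithinAt) hinj.injOn]
  refine setLIntegral_congr_fun measurableSet_Icc fun x hx => ?_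
  simp only [Pi.mul_apply]
  rw [hwv x hx, ENNReal.ofReal_mul (by norm_num), mul_assoc]
  congr 2
  norm_num [abs_div]

theorem image_f : f '' Icc (-1) 1 = Icc (-2) (-1) := by
  ext y
  constructor
  · rintro ⟨x, ⟨h₁, h₂⟩, rfl⟩
    constructor <;> unfold f <;> linarith
  · rintro ⟨h₁, h₂⟩
    exact ⟨-3 - 2 * y, ⟨by linarith, by linarith⟩, by unfold f; ring⟩

theorem image_g : g '' Icc (-1) 1 = Icc 1 2 := by
  ext y
  constructor
  · rintro ⟨x, ⟨h₁, h₂⟩, rfl⟩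
    constructor <;> unfold g <;> linarith
  · rintro ⟨h₁, h₂⟩
    exact ⟨3 - 2 * y, ⟨by linarith, by linarith⟩, by unfold g; ring⟩

/-- The coupling with disintegration `κ`, written as a sum over the three branches of `κ`. -/
def optimalCoupling : Measure (ℝ × ℝ) :=
  branch (fun x => (1 - x) / 12) f + branch (fun _ => 1 / 3) id + branch (fun x => (1 + x) / 12) g

theorem map_fst_optimalCoupling : optimalCoupling.map Prod.fst = μ₁ := by
  rw [optimalCoupling, Measure.map_add _ _ measurable_fst, Measure.map_add _ _ measurable_fst,
    map_fst_branch _ measurable_f, map_fst_branch _ measurable_id, map_fst_branch _ measurable_g,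
    ← withDensity_add_left (by fun_prop), ← withDensity_add_left (by fun_prop), μ₁_eq]
  refine withDensity_congr_ae ?_
  filter_upwards [ae_restrict_mem measurableSet_Icc] with x ⟨h₁, h₂⟩
  simp only [Pi.add_apply]
  rw [← ENNReal.ofReal_add (by linarith) (by norm_num),
    ← ENNReal.ofReal_add (by linarith) (by linarith)]
  congr 1
  ring

theorem map_snd_optimalCoupling : optimalCoupling.map Prod.snd = μ₂ := by
  rw [optimalCoupling, Measure.map_add _ _ measurable_snd, Measure.map_add _ _ measurable_snd,
    map_snd_branch _ measurable_f, map_snd_branch _ measurable_id, map_snd_branch _ measurable_g,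
    Measure.map_id, μ₂_eq,
    map_withDensity_of_hasDerivAt (v := fun s => (2 + s) / 3) hasDerivAt_f (by fun_prop)
      (fun x _ => by unfold f; ring) (by fun_prop)
      (fun x y h => by unfold f at h; linarith) image_f,
    map_withDensity_of_hasDerivAt (v := fun s => (2 - s) / 3) hasDerivAt_g (by fun_prop)
      (fun x _ => by unfold g; ring) (by fun_prop)
      (fun x y h => by unfold g at h; linarith) image_g]

instance isProbabilityMeasure_optimalCoupling : IsProbabilityMeasure optimalCoupling := by
  have : IsProbabilityMeasure (optimalCoupling.map Prod.fst) := by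
    rw [map_fst_optimalCoupling]; infer_instance
  exact Measure.isProbabilityMeasure_of_map Prod.fst

theorem optimalCoupling_prod {A B : Set ℝ} (hA : MeasurableSet A) (hB : MeasurableSet B) :
    optimalCoupling (A ×ˢ B) = ∫⁻ x in A, κ x B ∂μ₁ := by
  have hd {T : ℝ → ℝ} (hT : Measurable T) : Measurable fun x => Measure.dirac (T x) B :=
    (Measure.measurable_coe hB).comp (Measure.measurable_dirac.comp hT)
  have hdf := hd measurable_f
  have hdi : Measurable fun x => Measure.dirac (id x) B := hd measurable_id
  have hdg := hd measurable_g
  rw [optimalCoupling, Measure.add_apply, Measure.add_apply,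
    branch_prod _ measurable_f hA hB, branch_prod _ measurable_id hA hB,
    branch_prod _ measurable_g hA hB, ← lintegral_add_left (by fun_prop),
    ← lintegral_add_left (by fun_prop), μ₁_eq, withDensity_const, Measure.restrict_smul,
    lintegral_smul_measure, smul_eq_mul, ← lintegral_const_mul' _ _ ENNReal.ofReal_ne_top]
  refine lintegral_congr_ae ?_
  filter_upwards [ae_restrict_of_ae (ae_restrict_mem measurableSet_Icc)] with x hx
  simp only [κ, Measure.add_apply, Measure.smul_apply, smul_eq_mul, a_eq hx, c_eq hx, mul_add,
    ← mul_assoc, id]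
  rw [← ENNReal.ofReal_mul (by norm_num), ← ENNReal.ofReal_mul (by norm_num),
    ← ENNReal.ofReal_mul (by norm_num)]
  ring_nf

theorem integral_optimalCoupling {F : ℝ × ℝ → ℝ} (hF : Measurable F) {C : ℝ}
    (hC : ∀ p ∈ Icc (-1 : ℝ) 1 ×ˢ Icc (-2 : ℝ) 2, |F p| ≤ C) :
    ∫ p, F p ∂optimalCoupling = ∫ x in Icc (-1) 1,
      ((1 - x) / 12 * F (x, f x) + 1 / 3 * F (x, x) + (1 + x) / 12 * F (x, g x)) := by
  obtain ⟨i₁, j₁, e₁⟩ := integrable_branch (w := fun x => (1 - x) / 12) (by fun_prop)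
    (fun x hx => by linarith [hx.2]) (fun x hx => by linarith [hx.1]) measurable_f mapsTo_f hF hC
  obtain ⟨i₂, j₂, e₂⟩ := integrable_branch (w := fun _ => 1 / 3) (by fun_prop)
    (fun x hx => by norm_num) (fun x hx => by norm_num) measurable_id
    (fun x hx => ⟨by linarith [hx.1, id_eq x], by linarith [hx.2, id_eq x]⟩) hF hC
  obtain ⟨i₃, j₃, e₃⟩ := integrable_branch (w := fun x => (1 + x) / 12) (by fun_prop)
    (fun x hx => by linarith [hx.1]) (fun x hx => by linarith [hx.2]) measurable_g mapsTo_g hF hC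
  rw [optimalCoupling, integral_add_measure (i₁.add_measure i₂) i₃, integral_add_measure i₁ i₂,
    e₁, e₂, e₃, ← integral_add j₁ j₂]
  exact (integral_add (j₁.add j₂) j₃).symm

theorem isMartingaleCoupling_optimalCoupling :
    MOT2.IsMartingaleCoupling optimalCoupling μ₁ μ₂ := by
  refine ⟨inferInstance, map_fst_optimalCoupling, map_snd_optimalCoupling, ?_⟩
  rintro Δ hΔ ⟨C, hC⟩
  rw [integral_optimalCoupling (C := C * 3) (by fun_prop)]
  · refine integral_eq_zero_of_ae (.of_forall fun x => ?_)
    simp only [f, g, Pi.zero_apply]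
    ring
  · rintro ⟨x, y⟩ ⟨⟨h₁, h₂⟩, h₃, h₄⟩
    simp only at h₁ h₂ h₃ h₄
    rw [abs_mul]
    exact mul_le_mul (hC x) (abs_le.2 ⟨by linarith, by linarith⟩) (abs_nonneg _)
      ((abs_nonneg _).trans (hC x))

theorem integral_one_sub_sq_div_four : ∫ x in Icc (-1 : ℝ) 1, (1 - x ^ 2) / 4 = 1 / 3 := by
  rw [integral_Icc_eq_integral_Ioc, ← intervalIntegral.integral_of_le (by norm_num),
    intervalIntegral.integral_div, intervalIntegral.integral_sub (by simp) (by simp)]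
  norm_num

theorem integral_abs_sub_optimalCoupling :
    ∫ p : ℝ × ℝ, |p.2 - p.1| ∂optimalCoupling = 1 / 3 := by
  rw [integral_optimalCoupling (C := 3) (by fun_prop), ← integral_one_sub_sq_div_four]
  · refine setIntegral_congr_fun measurableSet_Icc fun x ⟨h₁, h₂⟩ => ?_
    simp only [f, g, sub_self, abs_zero]
    rw [abs_of_nonpos (by linarith), abs_of_nonneg (by linarith)]
    ring
  · rintro ⟨x, y⟩ ⟨⟨h₁, h₂⟩, h₃, h₄⟩
    simp only at h₁ h₂ h₃ h₄
    rw [abs_abs]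
    exact abs_le.2 ⟨by linarith, by linarith⟩

/-! ### The dual optimizer -/

/-- The static part of the dual optimizer. -/
def ψ (y : ℝ) : ℝ := if |y| ≤ 1 then 5 * y ^ 2 / 6 else 3 * |y| - 2 * y ^ 2 / 3 - 3 / 2

/-- The hedge ratio of the dual optimizer, truncated so as to be bounded. -/
def hedge (x : ℝ) : ℝ := if |x| ≤ 1 then -2 * x / 3 else 0

theorem measurable_ψ : Measurable ψ :=
  Measurable.ite (measurableSet_le (by fun_prop) (by fun_prop)) (by fun_prop) (by fun_prop)

theorem measurable_hedge : Measurable hedge :=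
  Measurable.ite (measurableSet_le (by fun_prop) (by fun_prop)) (by fun_prop) (by fun_prop)

theorem abs_hedge_le (x : ℝ) : |hedge x| ≤ 1 := by
  unfold hedge
  split_ifs with h
  · rw [abs_le] at h ⊢
    constructor <;> linarith [h.1, h.2]
  · simp

theorem ψ_of_abs_le {y : ℝ} (h₁ : -1 ≤ y) (h₂ : y ≤ 1) : ψ y = 5 * y ^ 2 / 6 :=
  if_pos (abs_le.2 ⟨h₁, h₂⟩)

theorem ψ_of_one_le {y : ℝ} (h : 1 ≤ y) : ψ y = 3 * y - 2 * y ^ 2 / 3 - 3 / 2 := by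
  rcases h.eq_or_lt with rfl | h
  · norm_num [ψ]
  · rw [ψ, abs_of_pos (by linarith), if_neg h.not_ge]

theorem ψ_of_le_neg_one {y : ℝ} (h : y ≤ -1) : ψ y = -3 * y - 2 * y ^ 2 / 3 - 3 / 2 := by
  have : ψ y = ψ (-y) := by simp [ψ]
  rw [this, ψ_of_one_le (by linarith)]
  ring

theorem abs_ψ_le {y : ℝ} (h₁ : -2 ≤ y) (h₂ : y ≤ 2) : |ψ y| ≤ 10 := by
  rw [abs_le]
  rcases le_total y (-1) with h | h
  · rw [ψ_of_le_neg_one h]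
    constructor <;> nlinarith
  rcases le_total y 1 with h' | h'
  · rw [ψ_of_abs_le h h']
    constructor <;> nlinarith
  · rw [ψ_of_one_le h']
    constructor <;> nlinarith

/-- The dual (semi-static subhedging) inequality. -/
theorem subhedge_le {x y : ℝ} (h₁ : -1 ≤ x) (h₂ : x ≤ 1) :
    ψ y - ψ x + hedge x * (y - x) ≤ |y - x| := by
  rw [ψ_of_abs_le h₁ h₂, hedge, if_pos (abs_le.2 ⟨h₁, h₂⟩)]
  rcases le_total y (-1) with h | h
  · rw [ψ_of_le_neg_one h, abs_of_nonpos (by linarith)]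
    nlinarith [sq_nonneg (y + (3 + x) / 2)]
  rcases le_total y 1 with h' | h'
  · rw [ψ_of_abs_le h h']
    rcases le_total x y with k | k
    · rw [abs_of_nonneg (by linarith)]
      nlinarith [mul_nonneg (sub_nonneg.2 k) (sub_nonneg.2 h'),
        mul_nonneg (sub_nonneg.2 k) (sub_nonneg.2 h₂)]
    · rw [abs_of_nonpos (by linarith)]
      nlinarith [mul_nonneg (sub_nonneg.2 k) (by linarith : 0 ≤ y + 1),
        mul_nonneg (sub_nonneg.2 k) (by linarith : 0 ≤ x + 1)]
  · rw [ψ_of_one_le h', abs_of_nonneg (by linarith)]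
    nlinarith [sq_nonneg (y - (3 - x) / 2)]

theorem abs_ψ_sub_le {p : ℝ × ℝ} (hp : p ∈ Icc (-1 : ℝ) 1 ×ˢ Icc (-2 : ℝ) 2) :
    |ψ p.2 - ψ p.1| ≤ 20 := by
  obtain ⟨⟨h₁, h₂⟩, h₃, h₄⟩ := hp
  refine (abs_sub _ _).trans ?_
  linarith [abs_ψ_le h₃ h₄, abs_ψ_le (y := p.1) (by linarith) (by linarith)]

theorem integral_ψ_sub_optimalCoupling :
    ∫ p : ℝ × ℝ, (ψ p.2 - ψ p.1) ∂optimalCoupling = 1 / 3 := by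
  have := measurable_ψ
  rw [integral_optimalCoupling (by fun_prop) fun p hp => abs_ψ_sub_le hp,
    ← integral_one_sub_sq_div_four]
  refine setIntegral_congr_fun measurableSet_Icc fun x ⟨h₁, h₂⟩ => ?_
  simp only
  rw [ψ_of_abs_le h₁ h₂, ψ_of_le_neg_one (by unfold f; linarith),
    ψ_of_one_le (by unfold g; linarith), f, g]
  ring

theorem ae_mem_of_isMartingaleCoupling {Q : Measure (ℝ × ℝ)}
    (hQ : MOT2.IsMartingaleCoupling Q μ₁ μ₂) :
    ∀ᵐ p ∂Q, p ∈ Icc (-1 : ℝ) 1 ×ˢ Icc (-2 : ℝ) 2 := by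
  obtain ⟨-, h₁, h₂, -⟩ := hQ
  have k₁ := ae_μ₁_mem
  have k₂ := ae_μ₂_mem
  rw [← h₁] at k₁
  rw [← h₂] at k₂
  filter_upwards [ae_of_ae_map measurable_fst.aemeasurable k₁,
    ae_of_ae_map measurable_snd.aemeasurable k₂] with p hp hp' using ⟨hp, hp'⟩

/-- The price of a static position depends on the coupling only through its marginals. -/
theorem integral_ψ_sub {Q : Measure (ℝ × ℝ)} (hQ : MOT2.IsMartingaleCoupling Q μ₁ μ₂) :
    ∫ p : ℝ × ℝ, (ψ p.2 - ψ p.1) ∂Q = ∫ y, ψ y ∂μ₂ - ∫ x, ψ x ∂μ₁ := by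
  have hbox := ae_mem_of_isMartingaleCoupling hQ
  obtain ⟨_, h₁, h₂, -⟩ := hQ
  have hψ := measurable_ψ
  rw [integral_sub, ← h₁, ← h₂,
    integral_map measurable_fst.aemeasurable hψ.aestronglyMeasurable,
    integral_map measurable_snd.aemeasurable hψ.aestronglyMeasurable]
  · refine Integrable.of_bound (hψ.comp measurable_snd).aestronglyMeasurable 10 ?_
    filter_upwards [hbox] with p hp using abs_ψ_le hp.2.1 hp.2.2
  · refine Integrable.of_bound (hψ.comp measurable_fst).aestronglyMeasurable 10 ?_
    filter_upwards [hbox] with p hp using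
      abs_ψ_le (by linarith [hp.1.1]) (by linarith [hp.1.2])

theorem one_third_le_integral_abs_sub {Q : Measure (ℝ × ℝ)}
    (hQ : MOT2.IsMartingaleCoupling Q μ₁ μ₂) : 1 / 3 ≤ ∫ p : ℝ × ℝ, |p.2 - p.1| ∂Q := by
  have hbox := ae_mem_of_isMartingaleCoupling hQ
  have hstatic : ∫ p : ℝ × ℝ, (ψ p.2 - ψ p.1) ∂Q = 1 / 3 := by
    rw [integral_ψ_sub hQ, ← integral_ψ_sub isMartingaleCoupling_optimalCoupling,
      integral_ψ_sub_optimalCoupling]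
  obtain ⟨_, -, -, hmart⟩ := hQ
  have hψ := measurable_ψ
  have hh := measurable_hedge
  have hdist {p : ℝ × ℝ} (hp : p ∈ Icc (-1 : ℝ) 1 ×ˢ Icc (-2 : ℝ) 2) : |p.2 - p.1| ≤ 3 :=
    abs_le.2 ⟨by linarith [hp.1.2, hp.2.1], by linarith [hp.1.1, hp.2.2]⟩
  have i₁ : Integrable (fun p : ℝ × ℝ => ψ p.2 - ψ p.1) Q := by
    refine Integrable.of_bound (by fun_prop) 20 ?_
    filter_upwards [hbox] with p hp using abs_ψ_sub_le hp
  have i₂ : Integrable (fun p : ℝ × ℝ => hedge p.1 * (p.2 - p.1)) Q := by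
    refine Integrable.of_bound (by fun_prop) 3 ?_
    filter_upwards [hbox] with p hp
    rw [Real.norm_eq_abs, abs_mul]
    exact (mul_le_of_le_one_left (abs_nonneg _) (abs_hedge_le _)).trans (hdist hp)
  have i₃ : Integrable (fun p : ℝ × ℝ => |p.2 - p.1|) Q := by
    refine Integrable.of_bound (by fun_prop) 3 ?_
    filter_upwards [hbox] with p hp
    rw [Real.norm_eq_abs, abs_abs]
    exact hdist hp
  calc (1 : ℝ) / 3 = ∫ p : ℝ × ℝ, (ψ p.2 - ψ p.1 + hedge p.1 * (p.2 - p.1)) ∂Q := by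
        rw [integral_add i₁ i₂, hstatic, hmart hedge hh ⟨1, abs_hedge_le⟩, add_zero]
    _ ≤ ∫ p : ℝ × ℝ, |p.2 - p.1| ∂Q := by
        refine integral_mono_ae (i₁.add i₂) i₃ ?_
        filter_upwards [hbox] with p hp using subhedge_le hp.1.1 hp.1.2

end ForwardStraddle

open ForwardStraddle in
/-- **Section 4.2 (optimal lower bound for the forward-start straddle).** For the
marginals `μ₁, μ₂` above, `inf {∫ |s₂ - s₁| dQ : Q ∈ M(μ₁, μ₂)} = 1/3`, and the infimum is
attained by the martingale measure whose disintegration with respect to `μ₁` is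
`Q_{s₁} = a(s₁) δ_{f(s₁)} + (2/3) δ_{s₁} + c(s₁) δ_{g(s₁)}`. -/
theorem forward_straddle_lower_bound :
    (∀ Q : Measure (ℝ × ℝ), MOT2.IsMartingaleCoupling Q μ₁ μ₂ →
        (1 : ℝ) / 3 ≤ ∫ p : ℝ × ℝ, |p.2 - p.1| ∂Q) ∧
    ∃ Q : Measure (ℝ × ℝ), MOT2.IsMartingaleCoupling Q μ₁ μ₂ ∧
      (∀ A B : Set ℝ, MeasurableSet A → MeasurableSet B →
        Q (A ×ˢ B) = ∫⁻ s₁ in A, κ s₁ B ∂μ₁) ∧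
      ∫ p : ℝ × ℝ, |p.2 - p.1| ∂Q = 1 / 3 := by
  exact ⟨fun Q hQ => one_third_le_integral_abs_sub hQ, optimalCoupling,
    isMartingaleCoupling_optimalCoupling, fun A B hA hB => optimalCoupling_prod hA hB,
    integral_abs_sub_optimalCoupling⟩
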